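/- arXiv:2105.08420 — 5 statements merged into one kernel-verified Lean document; each statement's English description precedes it below -/
import Mathlib

section
/- Let E be an Archimedean Riesz space, A a directed set, and μ a directed set measure on an interval field M of subsets of A. If a net (x_α)_{α∈A} in E is decreasing and relatively uniform convergent to 0, then (x_α)_{α∈A} is μ-statistically order convergent to 0. -/
/-- An interval field on a preordered set `A`: a field of subsets of `A`
containing every finite order interval `[a, b]`. -/
structure IntervalField (A : Type*) [Preorder A] where
  sets : Set (Set A)
  empty_mem : (∅ : Set A) ∈ sets
  univ_mem : (Set.univ : Set A) ∈ sets
  compl_mem : ∀ ⦃s : Set A⦄, s ∈ sets → sᶜ ∈ sets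
  union_mem : ∀ ⦃s t : Set A⦄, s ∈ sets → t ∈ sets → s ∪ t ∈ sets
  icc_mem : ∀ a b : A, (Set.Icc a b).Finite → Set.Icc a b ∈ sets

/-- A directed set measure: a finitely additive `μ : M → [0,1]` with
`μ(I) = 0` for finite order intervals, `μ(A) = 1`, and null sets hereditary
within `M`. -/
structure DirectedSetMeasure (A : Type*) [Preorder A] (M : IntervalField A) where
  μ : Set A → ℝ
  nonneg : ∀ ⦃s : Set A⦄, s ∈ M.sets → 0 ≤ μ s
  le_one : ∀ ⦃s : Set A⦄, s ∈ M.sets → μ s ≤ 1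
  empty : μ (∅ : Set A) = 0
  additive : ∀ ⦃s t : Set A⦄, s ∈ M.sets → t ∈ M.sets → Disjoint s t →
    μ (s ∪ t) = μ s + μ t
  icc_null : ∀ a b : A, (Set.Icc a b).Finite → μ (Set.Icc a b) = 0
  univ_one : μ (Set.univ : Set A) = 1
  null_mono : ∀ ⦃s t : Set A⦄, s ∈ M.sets → t ∈ M.sets → s ⊆ t → μ t = 0 → μ s = 0

/-- A net `p : A → E` is μ-statistically decreasing to `x` if there is
`Δ ∈ M` with `μ Δ = 1` such that the restricted net `(p_δ)_{δ ∈ Δ}` is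
decreasing with infimum `x`. -/
def StatDecreasingTo {A : Type*} [Preorder A] {E : Type*} [Lattice E] [AddCommGroup E]
    (M : IntervalField A) (m : DirectedSetMeasure A M) (p : A → E) (x : E) : Prop :=
  ∃ Δ ∈ M.sets, m.μ Δ = 1 ∧ AntitoneOn p Δ ∧ IsGLB (p '' Δ) x

/-- A net `x : A → E` is μ-statistically order convergent to `l` if there are a net
`p : A → E` and `Δ ∈ M` with `μ Δ = 1` such that `(p_δ)_{δ ∈ Δ}` is decreasing with
infimum `0` and `|x_δ - l| ≤ p_δ` for every `δ ∈ Δ`. -/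
def StatOrderConvTo {A : Type*} [Preorder A] {E : Type*} [Lattice E] [AddCommGroup E]
    (M : IntervalField A) (m : DirectedSetMeasure A M) (x : A → E) (l : E) : Prop :=
  ∃ (p : A → E) (Δ : Set A), Δ ∈ M.sets ∧ m.μ Δ = 1 ∧
    AntitoneOn p Δ ∧ IsGLB (p '' Δ) 0 ∧ ∀ δ ∈ Δ, |x δ - l| ≤ p δ

/-- Order convergence of a net in a Riesz space: `x_α → l` in order if there is a
decreasing net `p` with infimum `0` dominating `|x_α - l|`. -/
def OrderConvTo {A : Type*} [Preorder A] {E : Type*} [Lattice E] [AddCommGroup E]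
    (x : A → E) (l : E) : Prop :=
  ∃ p : A → E, Antitone p ∧ IsGLB (Set.range p) 0 ∧ ∀ α, |x α - l| ≤ p α

/-- In an Archimedean Riesz space, every decreasing relatively uniform null net
is μ-statistically order convergent to `0`. -/
theorem antitone_relUnifNull_implies_statOrderConvTo {A : Type*} [Preorder A] [IsDirected A (· ≤ ·)] [Nonempty A]
    {E : Type*} [Lattice E] [AddCommGroup E] [CovariantClass E E (· + ·) (· ≤ ·)]
    (M : IntervalField A) (m : DirectedSetMeasure A M)
    [Module ℝ E] [PosSMulMono ℝ E]
    (harch : ∀ v : E, 0 ≤ v →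
      IsGLB {y : E | ∃ n : ℕ, 0 < n ∧ y = (n : ℝ)⁻¹ • v} 0)
    (x : A → E) (hx : Antitone x)
    (hru : ∃ u : E, 0 ≤ u ∧ ∀ n : ℕ, 0 < n →
      ∃ α : A, ∀ β : A, α ≤ β → |x β - 0| ≤ (n : ℝ)⁻¹ • u) :
    StatOrderConvTo M m x 0 := by
  have : IsOrderedAddMonoid E := { add_le_add_left := fun _ _ h c => add_le_add_left h c }
  obtain ⟨u, hu, hconv⟩ := hru
  have le_zero : ∀ y : E, (∀ n : ℕ, 0 < n → y ≤ (n : ℝ)⁻¹ • u) → y ≤ 0 := fun y hy =>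
    (harch u hu).2 (by rintro _ ⟨n, hn, rfl⟩; exact hy n hn)
  have nonneg : ∀ β, 0 ≤ x β := fun β => by
    refine neg_nonpos.mp (le_zero _ fun n hn => ?_)
    obtain ⟨α, hα⟩ := hconv n hn
    obtain ⟨γ, hβγ, hαγ⟩ := exists_ge_ge β α
    have h := (neg_le_abs _).trans (hα γ hαγ)
    rw [sub_zero] at h
    exact (neg_le_neg (hx hβγ)).trans h
  refine ⟨x, Set.univ, M.univ_mem, m.univ_one, hx.antitoneOn _, ⟨?_, fun y hy => ?_⟩, fun δ _ => ?_⟩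
  · rintro _ ⟨β, -, rfl⟩
    exact nonneg β
  · refine le_zero y fun n hn => ?_
    obtain ⟨α, hα⟩ := hconv n hn
    have h := (le_abs_self _).trans (hα α le_rfl)
    rw [sub_zero] at h
    exact (hy ⟨α, Set.mem_univ α, rfl⟩).trans h
  · rw [sub_zero, abs_of_nonneg (nonneg δ)]
end

section
/- Let E be a Dedekind complete Riesz space, A a directed set, and μ a directed set measure on an interval field M of subsets of A. Then every order bounded monotone net in E indexed by A is μ-statistically order convergent: in particular, if (x_α)_{α∈A} is decreasing and bounded below, then (x_α) is μ-statistically order convergent to inf_{α∈A} x_α, and if (x_α)_{α∈A} is increasing and bounded above, then (x_α) is μ-statistically order convergent to sup_{α∈A} x_α. -/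
theorem OrderConvTo.statOrderConvTo {A : Type*} [Preorder A] {E : Type*} [Lattice E]
    [AddCommGroup E] {M : IntervalField A} (m : DirectedSetMeasure A M) {x : A → E} {l : E}
    (h : OrderConvTo x l) : StatOrderConvTo M m x l := by
  obtain ⟨p, hp, hp0, hxp⟩ := h
  exact ⟨p, Set.univ, M.univ_mem, m.univ_one, hp.antitoneOn _, by rwa [Set.image_univ],
    fun δ _ => hxp δ⟩

theorem Antitone.orderConvTo_of_isGLB {A : Type*} [Preorder A] {E : Type*} [Lattice E]
    [AddCommGroup E] [AddLeftMono E] {x : A → E} {l : E} (hx : Antitone x)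
    (hl : IsGLB (Set.range x) l) : OrderConvTo x l := by
  have hle : ∀ α, l ≤ x α := fun α => hl.1 (Set.mem_range_self α)
  refine ⟨fun α => x α - l, fun α β h => sub_le_sub_right (hx h) l, ⟨?_, fun b hb => ?_⟩,
    fun α => (abs_of_nonneg (sub_nonneg.2 (hle α))).le⟩
  · rintro _ ⟨α, rfl⟩
    exact sub_nonneg.2 (hle α)
  · have hbl : b + l ≤ l := hl.2 <| by
      rintro _ ⟨α, rfl⟩
      exact le_sub_iff_add_le.1 (hb (Set.mem_range_self α))
    simpa using hbl

theorem Monotone.orderConvTo_of_isLUB {A : Type*} [Preorder A] {E : Type*} [Lattice E]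
    [AddCommGroup E] [AddLeftMono E] {x : A → E} {l : E} (hx : Monotone x)
    (hl : IsLUB (Set.range x) l) : OrderConvTo x l := by
  have hle : ∀ α, x α ≤ l := fun α => hl.1 (Set.mem_range_self α)
  refine ⟨fun α => l - x α, fun α β h => sub_le_sub_left (hx h) l, ⟨?_, fun b hb => ?_⟩,
    fun α => ?_⟩
  · rintro _ ⟨α, rfl⟩
    exact sub_nonneg.2 (hle α)
  · have hbl : l ≤ l - b := hl.2 <| by
      rintro _ ⟨α, rfl⟩
      exact le_sub_comm.1 (hb (Set.mem_range_self α))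
    simpa using hbl
  · rw [abs_sub_comm]
    exact (abs_of_nonneg (sub_nonneg.2 (hle α))).le

/-- In a Dedekind complete Riesz space every order bounded monotone net is
μ-statistically order convergent: a decreasing net bounded below converges to its
infimum, and an increasing net bounded above converges to its supremum. -/
theorem monotone_orderBounded_statOrderConv_of_dedekindComplete {A : Type*} [Preorder A] [IsDirected A (· ≤ ·)] [Nonempty A]
    {E : Type*} [Lattice E] [AddCommGroup E] [CovariantClass E E (· + ·) (· ≤ ·)]
    (M : IntervalField A) (m : DirectedSetMeasure A M)
    (hDC : ∀ S : Set E, S.Nonempty → BddAbove S → ∃ s : E, IsLUB S s)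
    (x : A → E) :
    (Antitone x → BddBelow (Set.range x) →
      ∃ l : E, IsGLB (Set.range x) l ∧ StatOrderConvTo M m x l) ∧
    (Monotone x → BddAbove (Set.range x) →
      ∃ l : E, IsLUB (Set.range x) l ∧ StatOrderConvTo M m x l) := by
  refine ⟨fun hx hb => ?_, fun hx hb => ?_⟩
  · obtain ⟨l, hl⟩ :=
      hDC (lowerBounds (Set.range x)) hb (Set.range_nonempty x).bddAbove_lowerBounds
    have hl' := isLUB_lowerBounds.1 hl
    exact ⟨l, hl', (hx.orderConvTo_of_isGLB hl').statOrderConvTo m⟩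
  · obtain ⟨l, hl⟩ := hDC (Set.range x) (Set.range_nonempty x) hb
    exact ⟨l, hl, (hx.orderConvTo_of_isLUB hl).statOrderConvTo m⟩
end

section
/- Let E be a Riesz space, A a directed set, and μ a directed set measure on an interval field M of subsets of A. If the net (x_α)_{α∈A} in E is μ-statistically order convergent to x, then the net (|x_α|)_{α∈A} is μ-statistically order convergent to |x|. -/
/-- If `x_α` μ-statistically order converges to `x`, then `|x_α|` μ-statistically
order converges to `|x|`. -/
theorem statOrderConvTo_abs {A : Type*} [Preorder A] [IsDirected A (· ≤ ·)] [Nonempty A]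
    {E : Type*} [Lattice E] [AddCommGroup E] [CovariantClass E E (· + ·) (· ≤ ·)]
    (M : IntervalField A) (m : DirectedSetMeasure A M)
    (x : A → E) (l : E) (hx : StatOrderConvTo M m x l) :
    StatOrderConvTo M m (fun α => |x α|) |l| := by
  obtain ⟨p, Δ, hΔ, hμ, hp, hinf, hle⟩ := hx
  have : AddLeftMono E := ‹CovariantClass E E (· + ·) (· ≤ ·)›
  exact ⟨p, Δ, hΔ, hμ, hp, hinf, fun δ hδ => (abs_abs_sub_abs_le (x δ) l).trans (hle δ hδ)⟩
end

section
/- Let E be a Riesz space, A a directed set, and μ a directed set measure on an interval field M of subsets of A. If the net (x_α)_{α∈A} in E is μ-statistically order convergent to x, then the net of negative parts (x_α⁻)_{α∈A} is μ-statistically order convergent to x⁻. -/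
/-- If `x_α` μ-statistically order converges to `x`, then the negative parts
`x_α⁻ = (-x_α) ⊔ 0` μ-statistically order converge to `x⁻`. -/
theorem statOrderConvTo_negPart {A : Type*} [Preorder A] [IsDirected A (· ≤ ·)] [Nonempty A]
    {E : Type*} [Lattice E] [AddCommGroup E] [CovariantClass E E (· + ·) (· ≤ ·)]
    (M : IntervalField A) (m : DirectedSetMeasure A M)
    (x : A → E) (l : E) (hx : StatOrderConvTo M m x l) :
    StatOrderConvTo M m (fun α => (-x α) ⊔ 0) ((-l) ⊔ 0) := by
  have : AddLeftMono E := ‹CovariantClass E E (· + ·) (· ≤ ·)›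
  obtain ⟨p, Δ, hΔ, hμ, hp, hp_inf, hle⟩ := hx
  refine ⟨p, Δ, hΔ, hμ, hp, hp_inf, fun δ hδ => ?_⟩
  calc |(-x δ) ⊔ 0 - (-l) ⊔ 0| ≤ |-x δ - -l| := abs_sup_sub_sup_le_abs _ _ _
    _ = |x δ - l| := by rw [neg_sub_neg, abs_sub_comm]
    _ ≤ p δ := hle δ hδ
end

section
/- Let E be a Riesz space, A a directed set, and μ a directed set measure on an interval field M of subsets of A. The positive cone E₊ is closed under μ-statistical order convergence: if (x_α)_{α∈A} is a net in E with x_α ≥ 0 for every α ∈ A and (x_α) is μ-statistically order convergent to x ∈ E, then x ≥ 0. -/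
/-- The positive cone is closed under μ-statistical order convergence. -/
theorem statOrderConvTo_nonneg {A : Type*} [Preorder A] [IsDirected A (· ≤ ·)] [Nonempty A]
    {E : Type*} [Lattice E] [AddCommGroup E] [CovariantClass E E (· + ·) (· ≤ ·)]
    (M : IntervalField A) (m : DirectedSetMeasure A M)
    (x : A → E) (l : E)
    (hpos : ∀ α : A, 0 ≤ x α) (hx : StatOrderConvTo M m x l) :
    0 ≤ l := by
  obtain ⟨p, Δ, -, -, -, hglb, hle⟩ := hx
  have hlower : -l ∈ lowerBounds (p '' Δ) := by
    rintro _ ⟨δ, hδ, rfl⟩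
    calc -l ≤ -l + x δ := le_add_of_nonneg_right (hpos δ)
      _ = x δ - l := by rw [sub_eq_add_neg, add_comm]
      _ ≤ |x δ - l| := le_abs_self _
      _ ≤ p δ := hle δ hδ
  exact Left.neg_nonpos_iff.mp (hglb.2 hlower)
end
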